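/- Let μ be a Borel probability measure on the set GL⁺(2,ℝ) of 2×2 real matrices with positive determinant, such that A ↦ log⁺‖A‖_op and A ↦ log⁺‖A⁻¹‖_op are μ-integrable, and such that μ is SO(2)-invariant: for every rotation matrix O ∈ SO(2), the pushforward of μ under A ↦ O·A equals μ. Then ∫ log ρ(A) dμ(A) = ∫ ( (1/(2π)) ∫₀^{2π} log ‖A·u(θ)‖ dθ ) dμ(A), where ρ(A) denotes the spectral radius of A and u(θ) = (cos θ, sin θ). -/

import Mathlib

open MeasureTheory

noncomputable instance : MeasurableSpace (Matrix (Fin 2) (Fin 2) ℝ) := borel _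
instance : BorelSpace (Matrix (Fin 2) (Fin 2) ℝ) := ⟨rfl⟩

/-- The unit vector `(cos θ, sin θ)` in `ℝ²`. -/
noncomputable def unitVec (θ : ℝ) : Fin 2 → ℝ := ![Real.cos θ, Real.sin θ]

/-- Regard a pair of reals as a vector of the Euclidean plane (with the Euclidean norm). -/
noncomputable def toE2 (v : Fin 2 → ℝ) : EuclideanSpace ℝ (Fin 2) :=
  (WithLp.equiv 2 (Fin 2 → ℝ)).symm v

/-- The operator norm of a 2×2 real matrix acting on `ℝ²` with the Euclidean norm. -/
noncomputable def opNormR (A : Matrix (Fin 2) (Fin 2) ℝ) : ℝ :=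
  ‖Matrix.toEuclideanCLM (𝕜 := ℝ) A‖

/-- The spectral radius of a 2×2 real matrix: the maximum modulus of its complex
eigenvalues. -/
noncomputable def specRadR (A : Matrix (Fin 2) (Fin 2) ℝ) : ℝ :=
  (spectralRadius ℂ (A.map Complex.ofReal)).toReal

/-- The rotation matrix by angle `φ`. -/
noncomputable def rotMat (φ : ℝ) : Matrix (Fin 2) (Fin 2) ℝ :=
  !![Real.cos φ, -Real.sin φ; Real.sin φ, Real.cos φ]


noncomputable def rr (d t : ℝ) : ℝ := max (Real.sqrt d) (|t| + Real.sqrt (t ^ 2 - d))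

lemma exists_roots (d t : ℝ) (hd : 0 < d) : ∃ x y : ℂ, x + y = 2 * (t : ℂ) ∧ x * y = (d : ℂ) ∧
    ‖x‖ = rr d t ∧ ‖y‖ ≤ Real.sqrt d := by
  have hs : 0 < Real.sqrt d := Real.sqrt_pos.2 hd
  have hsq : Real.sqrt d ^ 2 = d := Real.sq_sqrt hd.le
  rcases le_or_gt (t ^ 2) d with h | h
  · have h1 : rr d t = Real.sqrt d := by
      unfold rr
      rw [Real.sqrt_eq_zero_of_nonpos (show t ^ 2 - d ≤ 0 by linarith), add_zero]
      exact max_eq_left (Real.abs_le_sqrt h)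
    set s := Real.sqrt (d - t ^ 2) with hsdef
    have hs2 : s ^ 2 = d - t ^ 2 := Real.sq_sqrt (by linarith)
    have hn : ∀ u : ℝ, u ^ 2 = s ^ 2 → ‖(t : ℂ) + u * Complex.I‖ = Real.sqrt d := by
      intro u hu
      rw [Complex.norm_add_mul_I, hu, hs2]; congr 1; ring
    refine ⟨t + (s : ℝ) * Complex.I, t + ((-s : ℝ) : ℂ) * Complex.I, ?_, ?_, ?_, ?_⟩
    · push_cast; ring
    · have : (d : ℂ) = (s : ℂ) ^ 2 + (t : ℂ) ^ 2 := by
        have : d = s ^ 2 + t ^ 2 := by linarith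
        exact_mod_cast this
      rw [this]; push_cast
      linear_combination (-(s : ℂ) ^ 2) * Complex.I_sq
    · rw [hn s rfl, h1]
    · rw [hn (-s) (by ring)]
  · set s := Real.sqrt (t ^ 2 - d) with hsdef
    have hs0 : 0 ≤ s := Real.sqrt_nonneg _
    have hs2 : s ^ 2 = t ^ 2 - d := Real.sq_sqrt (by linarith)
    have ht : Real.sqrt d ≤ |t| := Real.sqrt_le_iff.2 ⟨abs_nonneg _, by rw [sq_abs]; exact h.le⟩
    have h1 : rr d t = |t| + s := max_eq_right (by linarith)
    have hts : s ≤ |t| := Real.sqrt_le_iff.2 ⟨abs_nonneg _, by rw [sq_abs]; linarith⟩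
    have key : |t| - s ≤ Real.sqrt d := by
      have : (|t| - s) * (|t| + s) = Real.sqrt d ^ 2 := by
        rw [hsq]; nlinarith [sq_abs t]
      by_contra hc
      push Not at hc
      nlinarith
    have hdd : d = t ^ 2 - s ^ 2 := by linarith
    have hdc : (d : ℂ) = (t : ℂ) ^ 2 - (s : ℂ) ^ 2 := by exact_mod_cast hdd
    rcases le_total 0 t with h0 | h0
    · rw [abs_of_nonneg h0] at *
      refine ⟨((t + s : ℝ) : ℂ), ((t - s : ℝ) : ℂ), ?_, ?_, ?_, ?_⟩
      · push_cast; ring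
      · rw [hdc]; push_cast; ring
      · rw [Complex.norm_real, Real.norm_eq_abs, abs_of_nonneg (by linarith), h1]
      · rw [Complex.norm_real, Real.norm_eq_abs, abs_of_nonneg (by linarith)]; exact key
    · rw [abs_of_nonpos h0] at *
      refine ⟨((t - s : ℝ) : ℂ), ((t + s : ℝ) : ℂ), ?_, ?_, ?_, ?_⟩
      · push_cast; ring
      · rw [hdc]; push_cast; ring
      · rw [Complex.norm_real, Real.norm_eq_abs, abs_of_nonpos (by linarith), h1]; ring
      · rw [Complex.norm_real, Real.norm_eq_abs, abs_of_nonpos (by linarith)]; linarith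

lemma specRad_eq (A : Matrix (Fin 2) (Fin 2) ℝ) (hd : 0 < A.det) :
    specRadR A = rr A.det (A.trace / 2) := by
  obtain ⟨x, y, hxy, hm, hx, hy⟩ := exists_roots A.det (A.trace / 2) hd
  have hyx : ‖y‖ ≤ ‖x‖ := by rw [hx]; exact hy.trans (le_max_left _ _)
  have hspec : spectrum ℂ (A.map Complex.ofReal) = {x, y} := by
    ext z
    rw [Matrix.mem_spectrum_iff_isRoot_charpoly, Matrix.charpoly_fin_two]
    have h1 : (A.map Complex.ofReal).trace = x + y := by
      rw [hxy]; simp [Matrix.trace_fin_two]; ring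
    have h2 : (A.map Complex.ofReal).det = x * y := by
      rw [hm]; simp [Matrix.det_fin_two]
    rw [h1, h2]
    simp only [Polynomial.IsRoot, Polynomial.eval_add, Polynomial.eval_sub, Polynomial.eval_pow,
      Polynomial.eval_X, Polynomial.eval_mul, Polynomial.eval_C, Set.mem_insert_iff,
      Set.mem_singleton_iff]
    have : z ^ 2 - (x + y) * z + x * y = (z - x) * (z - y) := by ring
    rw [this, mul_eq_zero, sub_eq_zero, sub_eq_zero]
  unfold specRadR spectralRadius
  rw [hspec, iSup_pair, sup_eq_left.2, ← hx]
  · simp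
  · exact_mod_cast hyx

lemma log_mean (R c : ℝ) (hR : 0 < R) :
    IntervalIntegrable (fun α => Real.log |R * Real.cos α - c|) volume 0 (2 * Real.pi) ∧
    ∫ α in (0:ℝ)..(2 * Real.pi), Real.log |R * Real.cos α - c| =
      2 * Real.pi * Real.log (rr (R ^ 2) c / 2) := by
  have hR2 : Real.sqrt (R ^ 2) = R := Real.sqrt_sq hR.le
  obtain ⟨x, y, hxy, hm, hx, hy⟩ := exists_roots (R ^ 2) c (by positivity)
  have hrr : R ≤ rr (R ^ 2) c := hR2.symm.le.trans (le_max_left _ _)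
  rw [hR2] at hy
  have hpi := Real.pi_pos
  have Ix := circleIntegrable_log_norm_sub_const (a := x) (c := 0) R
  have Iy := circleIntegrable_log_norm_sub_const (a := y) (c := 0) R
  have Ax := circleAverage_log_norm_sub_const_eq_log_radius_add_posLog (a := x) (c := 0) hR.ne'
  have Ay := circleAverage_log_norm_sub_const_eq_log_radius_add_posLog (a := y) (c := 0) hR.ne'
  rw [zero_sub, norm_neg, hx, Real.posLog_eq_log (by
    rw [← div_eq_inv_mul, abs_of_nonneg (div_nonneg (by linarith) hR.le), le_div_iff₀ hR]; linarith),
    ← div_eq_inv_mul, Real.log_div (by linarith) hR.ne'] at Ax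
  rw [zero_sub, norm_neg, (Real.posLog_eq_zero_iff _).2 (by
    rw [abs_of_nonneg (by positivity), ← div_eq_inv_mul, div_le_iff₀ hR]; linarith)] at Ay
  rw [Real.circleAverage_def, smul_eq_mul, inv_mul_eq_iff_eq_mul₀ (by positivity)] at Ax Ay
  unfold CircleIntegrable at Ix Iy
  have hcount : Set.Countable {α : ℝ | R * Real.cos α - c = 0} := by
    by_cases h : ∃ β, R * Real.cos β - c = 0
    · obtain ⟨β, hβ⟩ := h
      refine Set.Countable.mono ?_ ((Set.countable_range (fun k : ℤ => 2 * k * Real.pi + β)).union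
        (Set.countable_range (fun k : ℤ => 2 * k * Real.pi - β)))
      intro α hα
      have : Real.cos β = Real.cos α := by
        have : R * Real.cos β = R * Real.cos α := by
          have : R * Real.cos α - c = 0 := hα
          linarith
        exact mul_left_cancel₀ hR.ne' this
      obtain ⟨k, hk | hk⟩ := Real.cos_eq_cos_iff.1 this
      · exact Or.inl ⟨k, hk.symm⟩
      · exact Or.inr ⟨k, hk.symm⟩
    · push Not at h
      convert Set.countable_empty
      ext α; simp [h α]
  have hae : ∀ᵐ α : ℝ, Real.log |R * Real.cos α - c| = Real.log ‖circleMap 0 R α - x‖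
      + Real.log ‖circleMap 0 R α - y‖ - Real.log (2 * R) := by
    have : ∀ᵐ α : ℝ, α ∉ {α : ℝ | R * Real.cos α - c = 0} := hcount.ae_notMem volume
    filter_upwards [this] with α hα
    have hα' : R * Real.cos α - c ≠ 0 := hα
    have hz : (circleMap 0 R α - x) * (circleMap 0 R α - y) =
        circleMap 0 R α * ((2 * (R * Real.cos α - c) : ℝ) : ℂ) := by
      have e1 : (circleMap 0 R α - x) * (circleMap 0 R α - y) =
        circleMap 0 R α ^ 2 - 2 * c * circleMap 0 R α + R ^ 2 := by
        have : (R : ℂ) ^ 2 = x * y := by rw [hm]; push_cast; rfl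
        rw [← hxy, this]; ring
      rw [e1]
      have e2 : circleMap 0 R α = R * (Complex.cos α + Complex.sin α * Complex.I) := by
        rw [circleMap_zero, Complex.exp_mul_I]
      rw [e2]
      push_cast
      linear_combination (R : ℂ) ^ 2 * Complex.sin α ^ 2 * Complex.I_sq
        - (R : ℂ) ^ 2 * Complex.sin_sq_add_cos_sq α
    have hn := congrArg norm hz
    rw [norm_mul, norm_mul, norm_circleMap_zero, Complex.norm_real, Real.norm_eq_abs,
      abs_of_pos hR, abs_mul, abs_two] at hn
    have hab : 0 < |R * Real.cos α - c| := abs_pos.2 hα'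
    have hne : ‖circleMap 0 R α - x‖ * ‖circleMap 0 R α - y‖ ≠ 0 := by rw [hn]; positivity
    rw [← Real.log_mul (left_ne_zero_of_mul hne) (right_ne_zero_of_mul hne), hn,
      show R * (2 * |R * Real.cos α - c|) = (2 * R) * |R * Real.cos α - c| by ring,
      Real.log_mul (by positivity) hab.ne']
    ring
  have Itot := (Ix.add Iy).sub (intervalIntegrable_const (μ := volume) (a := 0) (b := 2 * Real.pi)
    (c := Real.log (2 * R)))
  constructor
  · refine Itot.congr_ae (ae_restrict_of_ae ?_)
    filter_upwards [hae] with α h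
    rw [h]
  · rw [intervalIntegral.integral_congr_ae (g := fun α => Real.log ‖circleMap 0 R α - x‖
      + Real.log ‖circleMap 0 R α - y‖ - Real.log (2 * R)) (by
        filter_upwards [hae] with α h _ using h)]
    rw [intervalIntegral.integral_sub (Ix.add Iy) intervalIntegrable_const,
      intervalIntegral.integral_add Ix Iy, Ax, Ay, intervalIntegral.integral_const,
      Real.log_div (by linarith) two_ne_zero, Real.log_mul two_ne_zero hR.ne']
    simp; ring

lemma rr_pos (d t : ℝ) (hd : 0 < d) : 0 < rr d t :=
  lt_of_lt_of_le (Real.sqrt_pos.2 hd) (le_max_left _ _)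

lemma torus_mean (d r : ℝ) (hd : 0 < d) (hr : Real.sqrt d ≤ r) :
    ∫ φ in (0:ℝ)..(2 * Real.pi), Real.log (rr d (r * Real.cos φ)) =
      2 * Real.pi * Real.log r := by
  have hpi := Real.pi_pos
  have h2pi : (0:ℝ) ≤ 2 * Real.pi := by positivity
  set R := Real.sqrt d with hRdef
  have hR : 0 < R := Real.sqrt_pos.2 hd
  have hR2 : R ^ 2 = d := Real.sq_sqrt hd.le
  have hr0 : 0 < r := hR.trans_le hr
  -- inner integrals
  have inA : ∀ φ, ∫ α in (0:ℝ)..(2 * Real.pi), Real.log |R * Real.cos α - r * Real.cos φ| =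
      2 * Real.pi * (Real.log (rr d (r * Real.cos φ)) - Real.log 2) := by
    intro φ
    rw [(log_mean R (r * Real.cos φ) hR).2, hR2,
      Real.log_div (rr_pos _ _ hd).ne' two_ne_zero]
  have inB : ∀ α, IntervalIntegrable (fun φ => Real.log |R * Real.cos α - r * Real.cos φ|)
        volume 0 (2 * Real.pi) ∧
      ∫ φ in (0:ℝ)..(2 * Real.pi), Real.log |R * Real.cos α - r * Real.cos φ| =
      2 * Real.pi * (Real.log r - Real.log 2) := by
    intro α
    have := log_mean r (R * Real.cos α) hr0
    have hle : (R * Real.cos α) ^ 2 ≤ r ^ 2 := by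
      apply sq_le_sq'
      · nlinarith [Real.neg_one_le_cos α, Real.cos_le_one α]
      · nlinarith [Real.neg_one_le_cos α, Real.cos_le_one α]
    have hrr : rr (r ^ 2) (R * Real.cos α) = r := by
      unfold rr
      rw [Real.sqrt_eq_zero_of_nonpos (show (R * Real.cos α) ^ 2 - r ^ 2 ≤ 0 by linarith),
        add_zero, Real.sqrt_sq hr0.le]
      exact max_eq_left (abs_le_of_sq_le_sq hle hr0.le)
    rw [hrr, Real.log_div hr0.ne' two_ne_zero] at this
    simp only [abs_sub_comm (r * Real.cos _)] at this
    exact this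
  set ν : Measure ℝ := volume.restrict (Set.Ioc 0 (2 * Real.pi)) with hν
  set C : ℝ := Real.log (1 + R + r) with hC
  have hC0 : 0 ≤ C := Real.log_nonneg (by linarith)
  have hub : ∀ α φ, Real.log |R * Real.cos α - r * Real.cos φ| ≤ C := by
    intro α φ
    rcases eq_or_lt_of_le (abs_nonneg (R * Real.cos α - r * Real.cos φ)) with h | h
    · rw [← h, Real.log_zero]; exact hC0
    · apply Real.log_le_log h
      rw [abs_le]
      constructor <;>
      nlinarith [Real.neg_one_le_cos α, Real.cos_le_one α, Real.neg_one_le_cos φ,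
        Real.cos_le_one φ]
  let f : ℝ × ℝ → ℝ := fun p => C - Real.log |R * Real.cos p.2 - r * Real.cos p.1|
  have hmeas : Measurable f := by
    apply Measurable.const_sub
    apply Real.measurable_log.comp
    have : Continuous (fun p : ℝ × ℝ => |R * Real.cos p.2 - r * Real.cos p.1|) := by fun_prop
    exact this.measurable
  have hf0 : ∀ p, 0 ≤ f p := fun p => sub_nonneg.2 (hub _ _)
  have hfI : Integrable f (ν.prod ν) := by
    rw [integrable_prod_iff' hmeas.aestronglyMeasurable]
    have hi : ∀ α, Integrable (fun φ => f (φ, α)) ν := by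
      intro α
      have := (inB α).1
      rw [intervalIntegrable_iff_integrableOn_Ioc_of_le h2pi] at this
      exact (integrable_const C).sub this
    refine ⟨Filter.Eventually.of_forall hi, ?_⟩
    have : (fun α => ∫ φ, ‖f (φ, α)‖ ∂ν) = fun α =>
        2 * Real.pi * C - 2 * Real.pi * (Real.log r - Real.log 2) := by
      funext α
      simp only [Real.norm_eq_abs, abs_of_nonneg (hf0 _)]
      rw [← (inB α).2, ← intervalIntegral.integral_of_le h2pi,
        intervalIntegral.integral_sub intervalIntegrable_const (inB α).1]
      simp
    rw [this]
    exact integrable_const _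
  have hswap := integral_integral_swap (f := fun φ α => f (φ, α)) (μ := ν) (ν := ν) hfI
  simp only [hν, ← intervalIntegral.integral_of_le h2pi] at hswap
  have e1 : ∀ φ, ∫ α in (0:ℝ)..(2 * Real.pi), f (φ, α) =
     2 * Real.pi * C - 2 * Real.pi * (Real.log (rr d (r * Real.cos φ)) - Real.log 2) := by
    intro φ
    rw [← inA φ, intervalIntegral.integral_sub intervalIntegrable_const
      (log_mean R (r * Real.cos φ) hR).1]
    simp
  have e2 : ∀ α, ∫ φ in (0:ℝ)..(2 * Real.pi), f (φ, α) =
     2 * Real.pi * C - 2 * Real.pi * (Real.log r - Real.log 2) := by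
    intro α
    rw [← (inB α).2, intervalIntegral.integral_sub intervalIntegrable_const (inB α).1]
    simp
  simp only [e1, e2] at hswap
  have hcont : Continuous (fun φ => Real.log (rr d (r * Real.cos φ))) := by
    apply Continuous.log
    · unfold rr; fun_prop
    · intro φ; exact (rr_pos _ _ hd).ne'
  rw [intervalIntegral.integral_sub intervalIntegrable_const
    (Continuous.intervalIntegrable (by fun_prop) _ _),
    intervalIntegral.integral_const_mul (2 * Real.pi) (fun φ => Real.log (rr d (r * Real.cos φ))
      - Real.log 2),
    intervalIntegral.integral_sub (hcont.intervalIntegrable _ _) intervalIntegrable_const] at hswap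
  simp only [intervalIntegral.integral_const, smul_eq_mul, sub_zero] at hswap
  have h0 : (2 * Real.pi) ≠ 0 := by positivity
  apply mul_left_cancel₀ h0
  linarith

noncomputable def aa (A : Matrix (Fin 2) (Fin 2) ℝ) : ℂ :=
  ⟨(A 0 0 + A 1 1) / 2, (A 1 0 - A 0 1) / 2⟩
noncomputable def bb (A : Matrix (Fin 2) (Fin 2) ℝ) : ℂ :=
  ⟨(A 0 0 - A 1 1) / 2, (A 1 0 + A 0 1) / 2⟩

lemma normSq_aa_sub (A : Matrix (Fin 2) (Fin 2) ℝ) : ‖aa A‖ ^ 2 - ‖bb A‖ ^ 2 = A.det := by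
  rw [← Complex.normSq_eq_norm_sq, ← Complex.normSq_eq_norm_sq, Complex.normSq_apply,
    Complex.normSq_apply, Matrix.det_fin_two]
  simp only [aa, bb]; ring

lemma norm_mulVec (A : Matrix (Fin 2) (Fin 2) ℝ) (θ : ℝ) :
    ‖toE2 (A.mulVec (unitVec θ))‖ = ‖aa A * (circleMap 0 1 θ) ^ 2 + bb A‖ := by
  have h1 : ‖aa A * (circleMap 0 1 θ) ^ 2 + bb A‖ =
      ‖aa A * circleMap 0 1 θ + bb A * (starRingEnd ℂ) (circleMap 0 1 θ)‖ := by
    have hz : ‖circleMap 0 1 θ‖ = 1 := by simp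
    have hc : (circleMap 0 1 θ) * (starRingEnd ℂ) (circleMap 0 1 θ) = 1 := by
      rw [Complex.mul_conj, Complex.normSq_eq_norm_sq, hz]; simp
    have : aa A * (circleMap 0 1 θ) ^ 2 + bb A =
      (aa A * circleMap 0 1 θ + bb A * (starRingEnd ℂ) (circleMap 0 1 θ)) * circleMap 0 1 θ := by
      linear_combination (-bb A) * hc
    rw [this, norm_mul, hz, mul_one]
  have e2 : circleMap 0 1 θ = ⟨Real.cos θ, Real.sin θ⟩ := by
    rw [circleMap_zero, Complex.exp_mul_I]
    apply Complex.ext <;> simp [Complex.cos_ofReal_re, Complex.sin_ofReal_re]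
  rw [h1, e2, ← sq_eq_sq₀ (norm_nonneg _) (norm_nonneg _), ← Complex.normSq_eq_norm_sq,
    Complex.normSq_apply, EuclideanSpace.norm_sq_eq, Fin.sum_univ_two]
  simp [toE2, unitVec, aa, bb, Matrix.mulVec, dotProduct, Fin.sum_univ_two]
  ring

lemma rhs_mean (A : Matrix (Fin 2) (Fin 2) ℝ) (hd : 0 < A.det) :
    ∫ θ in (0:ℝ)..(2 * Real.pi), Real.log ‖toE2 (A.mulVec (unitVec θ))‖ =
      2 * Real.pi * Real.log ‖aa A‖ := by
  have hpi := Real.pi_pos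
  have hab : ‖bb A‖ ^ 2 < ‖aa A‖ ^ 2 := by linarith [normSq_aa_sub A]
  have hab' : ‖bb A‖ < ‖aa A‖ := lt_of_pow_lt_pow_left₀ 2 (norm_nonneg _) hab
  have ha : 0 < ‖aa A‖ := (norm_nonneg _).trans_lt hab'
  have ha0 : aa A ≠ 0 := norm_pos_iff.1 ha
  obtain ⟨l, hl⟩ := IsAlgClosed.exists_pow_nat_eq (-(bb A) / aa A) (n := 2) (by norm_num)
  have hl1 : ‖l‖ < 1 := by
    have : ‖l‖ ^ 2 < 1 := by
      rw [← norm_pow, hl, norm_div, norm_neg, div_lt_one ha]; exact hab'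
    nlinarith [norm_nonneg l]
  have Ix := circleIntegrable_log_norm_sub_const (a := l) (c := 0) 1
  have Iy := circleIntegrable_log_norm_sub_const (a := -l) (c := 0) 1
  have Ax := circleAverage_log_norm_sub_const₀ hl1
  have Ay := circleAverage_log_norm_sub_const₀ (a := -l) (by rwa [norm_neg])
  rw [Real.circleAverage_def, smul_eq_mul, inv_mul_eq_iff_eq_mul₀ (by positivity)] at Ax Ay
  unfold CircleIntegrable at Ix Iy
  have hne : ∀ w : ℂ, ‖w‖ < 1 → ∀ θ, ‖circleMap 0 1 θ - w‖ ≠ 0 := by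
    intro w hw θ h
    rw [norm_eq_zero, sub_eq_zero] at h
    rw [← h] at hw
    simp at hw
  have : ∀ θ, Real.log ‖toE2 (A.mulVec (unitVec θ))‖ = Real.log ‖aa A‖ +
      (Real.log ‖circleMap 0 1 θ - l‖ + Real.log ‖circleMap 0 1 θ - -l‖) := by
    intro θ
    have h1 := hne l hl1 θ
    have h2 := hne (-l) (by rwa [norm_neg]) θ
    rw [← Real.log_mul h1 h2, ← Real.log_mul ha.ne' (mul_ne_zero h1 h2), norm_mulVec,
      ← norm_mul, ← norm_mul]
    congr 2
    have : aa A * l ^ 2 = - bb A := by rw [hl]; field_simp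
    linear_combination this
  simp only [this]
  rw [intervalIntegral.integral_add intervalIntegrable_const (Ix.add Iy),
    intervalIntegral.integral_add Ix Iy, Ax, Ay]
  simp

noncomputable def gg (A : Matrix (Fin 2) (Fin 2) ℝ) : ℝ := Real.log (rr A.det (A.trace / 2))

lemma rot_det (A : Matrix (Fin 2) (Fin 2) ℝ) (φ : ℝ) : (rotMat φ * A).det = A.det := by
  rw [Matrix.det_mul]
  simp [rotMat, Matrix.det_fin_two, ← sq]

lemma rot_trace (A : Matrix (Fin 2) (Fin 2) ℝ) (φ : ℝ) :
    (rotMat φ * A).trace / 2 = ‖aa A‖ * Real.cos (φ + Complex.arg (aa A)) := by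
  have h1 := Complex.norm_mul_cos_arg (aa A)
  have h2 := Complex.norm_mul_sin_arg (aa A)
  have : ‖aa A‖ * Real.cos (φ + Complex.arg (aa A)) = Real.cos φ * (aa A).re
      - Real.sin φ * (aa A).im := by
    rw [Real.cos_add, ← h1, ← h2]; ring
  rw [this]
  rw [Matrix.trace_fin_two, Matrix.mul_apply, Matrix.mul_apply, Fin.sum_univ_two, Fin.sum_univ_two]
  simp only [rotMat, Matrix.of_apply, Matrix.cons_val', Matrix.cons_val_zero, Matrix.cons_val_one,
    Matrix.cons_val_fin_one, aa]
  ring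

lemma gg_mean (A : Matrix (Fin 2) (Fin 2) ℝ) (hd : 0 < A.det) :
    ∫ φ in (0:ℝ)..(2 * Real.pi), gg (rotMat φ * A) = 2 * Real.pi * Real.log ‖aa A‖ := by
  have hr : Real.sqrt A.det ≤ ‖aa A‖ :=
    Real.sqrt_le_iff.2 ⟨norm_nonneg _, by nlinarith [normSq_aa_sub A, sq_nonneg ‖bb A‖]⟩
  rw [← torus_mean A.det ‖aa A‖ hd hr]
  unfold gg
  simp only [rot_det, rot_trace]
  have hp : Function.Periodic (fun φ => Real.log (rr A.det (‖aa A‖ * Real.cos φ)))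
      (2 * Real.pi) := by
    intro φ; simp
  rw [intervalIntegral.integral_comp_add_right
    (fun φ => Real.log (rr A.det (‖aa A‖ * Real.cos φ)))]
  have := hp.intervalIntegral_add_eq (Complex.arg (aa A)) 0
  rw [zero_add] at this ⊢
  rw [← this, add_comm]

lemma entry_le (A : Matrix (Fin 2) (Fin 2) ℝ) (i j : Fin 2) : |A i j| ≤ opNormR A := by
  have h := (Matrix.toEuclideanCLM (𝕜 := ℝ) A).le_opNorm (EuclideanSpace.single j (1:ℝ))
  rw [EuclideanSpace.norm_single, norm_one, mul_one] at h
  refine le_trans ?_ h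
  have := PiLp.norm_apply_le ((Matrix.toEuclideanCLM (𝕜 := ℝ) A) (EuclideanSpace.single j (1:ℝ))) i
  rw [Matrix.ofLp_toEuclideanCLM] at this
  simpa using this

lemma gg_upper (A : Matrix (Fin 2) (Fin 2) ℝ) (hd : 0 < A.det) :
    gg A ≤ Real.log 2 + max (Real.log (opNormR A)) 0 := by
  set M := opNormR A with hM
  have h00 := entry_le A 0 0
  have h01 := entry_le A 0 1
  have h10 := entry_le A 1 0
  have h11 := entry_le A 1 1
  rw [← hM] at h00 h01 h10 h11
  have hM0 : 0 ≤ M := (abs_nonneg _).trans h00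
  have hdM : A.det ≤ 2 * M ^ 2 := by
    rw [Matrix.det_fin_two]
    have a1 : A 0 0 * A 1 1 ≤ M * M :=
      (le_abs_self _).trans (by rw [abs_mul]; gcongr)
    have a2 : -(A 0 1 * A 1 0) ≤ M * M :=
      (neg_le_abs _).trans (by rw [abs_mul]; gcongr)
    nlinarith
  have hMp : 0 < M := by
    rcases hM0.eq_or_lt with h | h
    · rw [← h] at hdM; nlinarith
    · exact h
  have ht : |A.trace / 2| ≤ M := by
    rw [Matrix.trace_fin_two, abs_le]
    rw [abs_le] at h00 h11
    constructor <;> linarith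
  have : rr A.det (A.trace / 2) ≤ 2 * M := by
    apply max_le
    · exact Real.sqrt_le_iff.2 ⟨by positivity, by nlinarith⟩
    · have : Real.sqrt ((A.trace / 2) ^ 2 - A.det) ≤ M :=
        Real.sqrt_le_iff.2 ⟨hM0, by nlinarith [sq_abs (A.trace / 2), abs_nonneg (A.trace / 2)]⟩
      linarith
  calc gg A ≤ Real.log (2 * M) := Real.log_le_log (rr_pos _ _ hd) this
    _ = Real.log 2 + Real.log M := Real.log_mul two_ne_zero hMp.ne'
    _ ≤ _ := by gcongr; exact le_max_left _ _

lemma gg_lower (A : Matrix (Fin 2) (Fin 2) ℝ) (hd : 0 < A.det) :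
    -(Real.log 2 + max (Real.log (opNormR A⁻¹)) 0) ≤ gg A := by
  have hdi : A⁻¹.det = (A.det)⁻¹ := by rw [Matrix.det_nonsing_inv, Ring.inverse_eq_inv']
  have hd' : 0 < A⁻¹.det := by rw [hdi]; positivity
  have h1 := gg_upper A⁻¹ hd'
  have h2 : Real.log (Real.sqrt A⁻¹.det) ≤ gg A⁻¹ :=
    Real.log_le_log (Real.sqrt_pos.2 hd') (le_max_left _ _)
  have h3 : Real.log (Real.sqrt A.det) ≤ gg A :=
    Real.log_le_log (Real.sqrt_pos.2 hd) (le_max_left _ _)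
  rw [hdi, Real.sqrt_inv, Real.log_inv] at h2
  linarith

lemma gg_abs (A : Matrix (Fin 2) (Fin 2) ℝ) (hd : 0 < A.det) :
    |gg A| ≤ Real.log 2 + max (Real.log (opNormR A)) 0 + max (Real.log (opNormR A⁻¹)) 0 := by
  rw [abs_le]
  have h1 := gg_upper A hd
  have h2 := gg_lower A hd
  have := le_max_right (Real.log (opNormR A)) 0
  have := le_max_right (Real.log (opNormR A⁻¹)) 0
  constructor <;> linarith

/-- (Dedieu–Shub) Let `μ` be an `SO(2)`-invariant Borel probability measure on `GL⁺(2,ℝ)`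
with `log⁺‖A‖` and `log⁺‖A⁻¹‖` integrable.  Then
`∫ log ρ(A) dμ(A) = ∫ (1/(2π)) ∫₀^{2π} log ‖A·u(θ)‖ dθ dμ(A)`. -/
theorem so2_invariant_GLplus_equality
    (μ : Measure (Matrix (Fin 2) (Fin 2) ℝ)) [IsProbabilityMeasure μ]
    (hdet : μ {A | 0 < A.det}ᶜ = 0)
    (hlog1 : Integrable (fun A => max (Real.log (opNormR A)) 0) μ)
    (hlog2 : Integrable (fun A => max (Real.log (opNormR A⁻¹)) 0) μ)
    (hinv : ∀ φ : ℝ, Measure.map (fun A => rotMat φ * A) μ = μ) :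
    ∫ A, Real.log (specRadR A) ∂μ =
      ∫ A, ((1 / (2 * Real.pi)) *
        ∫ θ in (0:ℝ)..(2 * Real.pi), Real.log ‖toE2 (A.mulVec (unitVec θ))‖) ∂μ := by
  have hpi := Real.pi_pos
  have h2pi : (0:ℝ) ≤ 2 * Real.pi := by positivity
  have hpos : ∀ᵐ A ∂μ, 0 < A.det := by rw [ae_iff]; exact hdet
  have : SecondCountableTopology (Matrix (Fin 2) (Fin 2) ℝ) :=
    inferInstanceAs (SecondCountableTopology (Fin 2 → Fin 2 → ℝ))
  have hggm : Measurable gg := by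
    apply Real.measurable_log.comp
    have : Continuous (fun A : Matrix (Fin 2) (Fin 2) ℝ => rr A.det (A.trace / 2)) := by
      have h1 : Continuous (fun A : Matrix (Fin 2) (Fin 2) ℝ => A.det) :=
        Continuous.matrix_det continuous_id
      have h2 : Continuous (fun A : Matrix (Fin 2) (Fin 2) ℝ => A.trace) :=
        Continuous.matrix_trace continuous_id
      unfold rr; fun_prop
    exact this.measurable
  have hrot : Continuous rotMat := by
    refine continuous_matrix fun i j => ?_
    fin_cases i <;> fin_cases j <;> simp [rotMat] <;> fun_prop
  have rotMul_cont : ∀ φ, Continuous (fun A : Matrix (Fin 2) (Fin 2) ℝ => rotMat φ * A) :=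
    fun φ => continuous_const.matrix_mul continuous_id
  have hmulm : Measurable (fun p : Matrix (Fin 2) (Fin 2) ℝ × ℝ => rotMat p.2 * p.1) := by
    have : Continuous (fun p : Matrix (Fin 2) (Fin 2) ℝ × ℝ => rotMat p.2 * p.1) :=
      (hrot.comp continuous_snd).matrix_mul continuous_fst
    exact this.measurable
  have hinvg : ∀ φ, ∫ A, gg (rotMat φ * A) ∂μ = ∫ A, gg A ∂μ := by
    intro φ
    have hm : Measurable (fun A : Matrix (Fin 2) (Fin 2) ℝ => rotMat φ * A) :=
      (rotMul_cont φ).measurable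
    conv_rhs => rw [← hinv φ]
    rw [integral_map hm.aemeasurable hggm.aestronglyMeasurable]
  have hopI : Integrable (fun A => Real.log 2 + max (Real.log (opNormR A)) 0 +
      max (Real.log (opNormR A⁻¹)) 0) μ := ((integrable_const _).add hlog1).add hlog2
  set ν : Measure ℝ := volume.restrict (Set.Ioc 0 (2 * Real.pi)) with hν
  have hggI : Integrable gg μ := by
    refine hopI.mono' hggm.aestronglyMeasurable ?_
    filter_upwards [hpos] with A hA using gg_abs A hA
  have hF : Integrable (fun p : Matrix (Fin 2) (Fin 2) ℝ × ℝ => gg (rotMat p.2 * p.1))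
      (μ.prod ν) := by
    have hFm : Measurable (fun p : Matrix (Fin 2) (Fin 2) ℝ × ℝ => gg (rotMat p.2 * p.1)) :=
      hggm.comp hmulm
    rw [integrable_prod_iff' hFm.aestronglyMeasurable]
    have hm := fun φ => (rotMul_cont φ).measurable
    constructor
    · refine Filter.Eventually.of_forall fun φ => ?_
      have : Integrable gg (Measure.map (fun A => rotMat φ * A) μ) := by rw [hinv φ]; exact hggI
      exact this.comp_measurable (hm φ)
    · have : (fun φ => ∫ A, ‖gg (rotMat φ * A)‖ ∂μ) = fun _ => ∫ A, ‖gg A‖ ∂μ := by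
        funext φ
        conv_rhs => rw [← hinv φ]
        rw [integral_map (hm φ).aemeasurable hggm.norm.aestronglyMeasurable]
      rw [this]
      exact integrable_const _
  have hswap := integral_integral_swap (f := fun A φ => gg (rotMat φ * A)) (μ := μ) (ν := ν) hF
  simp only [hinvg, hν, ← intervalIntegral.integral_of_le h2pi] at hswap
  rw [intervalIntegral.integral_const, sub_zero, smul_eq_mul] at hswap
  have hL : ∫ A, Real.log (specRadR A) ∂μ = ∫ A, gg A ∂μ := by
    apply integral_congr_ae
    filter_upwards [hpos] with A hA
    rw [specRad_eq A hA, gg]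
  rw [hL, integral_const_mul]
  have hR : ∫ A, (∫ θ in (0:ℝ)..(2 * Real.pi), Real.log ‖toE2 (A.mulVec (unitVec θ))‖) ∂μ =
      ∫ A, (∫ φ in (0:ℝ)..(2 * Real.pi), gg (rotMat φ * A)) ∂μ := by
    apply integral_congr_ae
    filter_upwards [hpos] with A hA
    rw [rhs_mean A hA, gg_mean A hA]
  rw [hR, hswap]
  field_simp
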